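/- Let A ∈ ℝ and q ∈ [0,R] with H(q) < A. Then G_A is differentiable at the point H'(q), with G_A'(H'(q)) = −q. -/

import Mathlib

open Set

noncomputable section

/-- `G_A(p) = sup_{y ∈ [0,R]} (−p y + min{H(y), A})`. -/
def GA (H : ℝ → ℝ) (R A p : ℝ) : ℝ := sSup ((fun y => -(p * y) + min (H y) A) '' Icc 0 R)

/-- Away from a strict maximizer on a compact set, a continuous function stays below its maximum
by a positive gap. -/
theorem IsCompact.exists_pos_gap_of_strict_max {K : Set ℝ} (hK : IsCompact K) {g : ℝ → ℝ}
    (hg : ContinuousOn g K) {q : ℝ} (hmax : ∀ y ∈ K, y ≠ q → g y < g q) {ε : ℝ} (hε : 0 < ε) :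
    ∃ δ > 0, ∀ y ∈ K, ε ≤ |y - q| → g y + δ ≤ g q := by
  have hclosed : IsClosed {y : ℝ | ε ≤ |y - q|} := isClosed_le (by fun_prop) (by fun_prop)
  rcases (K ∩ {y : ℝ | ε ≤ |y - q|}).eq_empty_or_nonempty with h | h
  · refine ⟨1, one_pos, fun y hy hyq => ?_⟩
    have hmem : y ∈ K ∩ {y : ℝ | ε ≤ |y - q|} := ⟨hy, hyq⟩
    simp [h] at hmem
  · obtain ⟨z, hz, hzmax⟩ := (hK.inter_right hclosed).exists_isMaxOn h (hg.mono inter_subset_left)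
    have hzq : z ≠ q := by
      rintro rfl
      have : ε ≤ |z - z| := hz.2
      simp at this
      linarith
    refine ⟨g q - g z, sub_pos.2 (hmax z hz.1 hzq), fun y hy hyq => ?_⟩
    have : g y ≤ g z := hzmax ⟨hy, hyq⟩
    linarith

/-- Danskin's theorem for the conjugate of a continuous function on a compact set of reals: at a
slope with a unique maximizer `q`, the derivative is `-q`. -/
theorem hasDerivAt_sSup_neg_mul_add {K : Set ℝ} (hK : IsCompact K) {f : ℝ → ℝ}
    (hf : ContinuousOn f K) {p₀ q : ℝ} (hq : q ∈ K)
    (hmax : ∀ y ∈ K, y ≠ q → -(p₀ * y) + f y < -(p₀ * q) + f q) :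
    HasDerivAt (fun p => sSup ((fun y => -(p * y) + f y) '' K)) (-q) p₀ := by
  have hcont (p : ℝ) : ContinuousOn (fun y => -(p * y) + f y) K := by fun_prop
  have hle (p y : ℝ) (hy : y ∈ K) : -(p * y) + f y ≤ sSup ((fun y => -(p * y) + f y) '' K) :=
    le_csSup (hK.bddAbove_image (hcont p)) (mem_image_of_mem _ hy)
  have hge (p c : ℝ) (h : ∀ y ∈ K, -(p * y) + f y ≤ c) :
      sSup ((fun y => -(p * y) + f y) '' K) ≤ c :=
    csSup_le (Nonempty.image _ ⟨q, hq⟩) (forall_mem_image.2 h)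
  have hsup : sSup ((fun y => -(p₀ * y) + f y) '' K) = -(p₀ * q) + f q := by
    refine le_antisymm (hge _ _ fun y hy => ?_) (hle _ _ hq)
    rcases eq_or_ne y q with rfl | hne
    exacts [le_rfl, (hmax y hy hne).le]
  obtain ⟨D, hD⟩ := hK.exists_bound_of_continuousOn (f := fun y => y - q) (by fun_prop)
  have hD0 : 0 ≤ D := (norm_nonneg _).trans (hD q hq)
  rw [hasDerivAt_iff_isLittleO, Asymptotics.isLittleO_iff]
  intro ε hε
  obtain ⟨δ, hδ, hgap⟩ := hK.exists_pos_gap_of_strict_max (hcont p₀) hmax hε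
  filter_upwards [Metric.ball_mem_nhds p₀ (div_pos hδ (by linarith : 0 < D + 1))] with p hp
  rw [Metric.mem_ball, Real.dist_eq, lt_div_iff₀ (by linarith)] at hp
  simp only [hsup, Real.norm_eq_abs, smul_eq_mul] at hD ⊢
  have hlow := hle p q hq
  have hupp : sSup ((fun y => -(p * y) + f y) '' K) ≤
      -(p * q) + f q + ε * |p - p₀| := by
    refine hge _ _ fun y hy => ?_
    have hprod : -((p - p₀) * (y - q)) ≤ |p - p₀| * |y - q| := by
      rw [← abs_mul]
      exact neg_le_abs _
    rcases lt_or_ge |y - q| ε with hlt | hfar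
    · have h₁ : |p - p₀| * |y - q| ≤ |p - p₀| * ε := by gcongr
      have h₂ : -(p₀ * y) + f y ≤ -(p₀ * q) + f q := hsup ▸ hle p₀ y hy
      linarith
    · have h₁ : |p - p₀| * |y - q| ≤ |p - p₀| * D := by
        gcongr
        exact hD y hy
      have h₂ := hgap y hy hfar
      have h₃ : 0 ≤ ε * |p - p₀| := by positivity
      have h₄ := abs_nonneg (p - p₀)
      linarith
  rw [abs_le]
  have h₃ : 0 ≤ ε * |p - p₀| := by positivity
  constructor <;> linarith

/-- A strictly concave function lies strictly below its tangent lines. -/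
theorem StrictConcaveOn.lt_tangent {S : Set ℝ} {f : ℝ → ℝ} (hf : StrictConcaveOn ℝ S f)
    {x y f' : ℝ} (hx : x ∈ S) (hy : y ∈ S) (hne : y ≠ x) (hd : HasDerivAt f f' x) :
    f y < f x + f' * (y - x) := by
  rcases hne.lt_or_gt with h | h
  · have := hf.lt_slope_of_hasDerivAt hy hx h hd
    rw [slope_def_field, lt_div_iff₀ (sub_pos.2 h)] at this
    linarith
  · have := hf.slope_lt_of_hasDerivAt hx hy h hd
    rw [slope_def_field, div_lt_iff₀ (sub_pos.2 h)] at this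
    linarith

/-- if `H(q) < A` then `G_A` is differentiable at `H'(q)` with
`G_A'(H'(q)) = −q`. -/
theorem GA_deriv
    (R : ℝ) (hR : 0 < R) (H : ℝ → ℝ) (hH : ContDiff ℝ 1 H)
    (hconc : StrictConcaveOn ℝ (Icc 0 R) H)
    (A : ℝ) (q : ℝ) (hq : q ∈ Icc 0 R) (hA : H q < A) :
    HasDerivAt (GA H R A) (-q) (deriv H q) := by
  have hcont : Continuous H := hH.continuous
  refine hasDerivAt_sSup_neg_mul_add isCompact_Icc (f := fun y => min (H y) A)
    (by fun_prop) hq fun y hy hne => ?_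
  have htan := hconc.lt_tangent hq hy hne (hH.differentiable one_ne_zero q).hasDerivAt
  have hmin := min_le_left (H y) A
  rw [min_eq_left hA.le]
  linarith
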